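/- arXiv:0901.4734 — 2 statements merged into one kernel-verified Lean document; each statement's English description precedes it below -/
import Mathlib

section
/- Let H ≤ F be a subgroup, B_X^n = { x ∈ H\F : |x|_X ≤ n }, and let v_X = limsup_{n→∞} |B_X^n|^{1/n} be the exponential growth rate of the Schreier graph of H. If v_X < 2m−1, then the action of H on (∂F, μ) is conservative: every measurable W ⊆ ∂F with μ(hW ∩ h′W) = 0 for all h ≠ h′ in H has μ(W) = 0. -/
open MeasureTheory Filter Topology
open scoped ENNReal symmDiff

noncomputable section

/-- A letter of the alphabet `A ∪ A⁻¹` for the free group on `Fin m`. -/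
abbrev Letter (m : ℕ) := Fin m × Bool

/-- The inverse letter. -/
def linv {m : ℕ} (x : Letter m) : Letter m := (x.1, !x.2)

/-- A sequence of letters is reduced if no letter is followed by its inverse. -/
def IsRedSeq {m : ℕ} (ω : ℕ → Letter m) : Prop := ∀ n, ω (n + 1) ≠ linv (ω n)

/-- The boundary `∂F`: infinite reduced words. -/
abbrev Boundary (m : ℕ) := {ω : ℕ → Letter m // IsRedSeq ω}

/-- Word length of an element of the free group. -/
def wlen {m : ℕ} (g : FreeGroup (Fin m)) : ℕ := g.toWord.length

/-- The truncation `[ω]ₙ`: the group element given by the first `n` letters of `ω`. -/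
def trunc {m : ℕ} (ω : Boundary m) (n : ℕ) : FreeGroup (Fin m) :=
  FreeGroup.mk (List.ofFn fun i : Fin n => ω.1 i)

/-- Cylinder set `C_g`. -/
def cylinder {m : ℕ} (g : FreeGroup (Fin m)) : Set (Boundary m) :=
  {ω | trunc ω (wlen g) = g}

/-- The Gromov product `(g|ω)`: length of the longest common initial segment of the
reduced word of `g` and `ω`. -/
def gromov {m : ℕ} (g : FreeGroup (Fin m)) (ω : Boundary m) : ℕ :=
  sSup {k | ∀ i < k, g.toWord[i]? = some (ω.1 i)}

/-- The Busemann function `b_ω(g) = |g| - 2 (g|ω)`. -/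
def busemann {m : ℕ} (g : FreeGroup (Fin m)) (ω : Boundary m) : ℤ :=
  (wlen g : ℤ) - 2 * (gromov g ω : ℤ)

/-- The number of letters cancelled in the free reduction of the concatenation
of a finite word `w` with an infinite reduced word `ω`. -/
def cancelLen {m : ℕ} (w : List (Letter m)) (ω : ℕ → Letter m) : ℕ :=
  sSup {k | k ≤ w.length ∧ ∀ i < k, w[w.length - 1 - i]? = some (linv (ω i))}

/-- The sequence of letters of the free reduction of (reduced word of `g`) ++ `ω`. -/
def actSeq {m : ℕ} (g : FreeGroup (Fin m)) (ω : Boundary m) (n : ℕ) : Letter m :=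
  if h : n < g.toWord.length - cancelLen g.toWord ω.1
  then g.toWord[n]'(by omega)
  else ω.1 (n - (g.toWord.length - cancelLen g.toWord ω.1) + cancelLen g.toWord ω.1)

theorem linv_linv {m : ℕ} (x : Letter m) : linv (linv x) = x := by
  simp [linv]

theorem toWord_chain {m : ℕ} (g : FreeGroup (Fin m)) {j : ℕ} (hj : j + 1 < g.toWord.length) :
    g.toWord[j + 1]'hj ≠ linv (g.toWord[j]'(by omega)) := by
  intro h
  have hsplit : g.toWord = g.toWord.take j ++
      (g.toWord[j]'(by omega)) :: (g.toWord[j+1]'hj) :: g.toWord.drop (j + 2) := by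
    conv_lhs => rw [← List.take_append_drop j g.toWord]
    congr 1
    rw [List.drop_eq_getElem_cons (by omega)]
    congr 1
    rw [List.drop_eq_getElem_cons (by omega)]
  rw [h] at hsplit
  have hred : FreeGroup.reduce g.toWord = g.toWord := FreeGroup.reduce_toWord g
  exact FreeGroup.reduce.not (by rw [hred, hsplit]; rfl)

theorem cancelLen_spec {m : ℕ} (w : List (Letter m)) (ω : ℕ → Letter m) :
    cancelLen w ω ≤ w.length ∧
      ∀ i < cancelLen w ω, w[w.length - 1 - i]? = some (linv (ω i)) := by
  have : cancelLen w ω ∈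
      {k | k ≤ w.length ∧ ∀ i < k, w[w.length - 1 - i]? = some (linv (ω i))} := by
    apply Nat.sSup_mem ⟨0, by simp⟩ ⟨w.length, fun x hx => hx.1⟩
  exact this

theorem cancelLen_max {m : ℕ} (w : List (Letter m)) (ω : ℕ → Letter m)
    (hlt : cancelLen w ω < w.length) :
    w[w.length - 1 - cancelLen w ω]? ≠ some (linv (ω (cancelLen w ω))) := by
  intro hcon
  have hmem : cancelLen w ω + 1 ∈
      {k | k ≤ w.length ∧ ∀ i < k, w[w.length - 1 - i]? = some (linv (ω i))} := by
    refine ⟨hlt, fun i hi => ?_⟩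
    rcases Nat.lt_succ_iff_lt_or_eq.mp hi with h | h
    · exact (cancelLen_spec w ω).2 i h
    · subst h; exact hcon
  have := le_csSup ⟨w.length, fun x hx => hx.1⟩ hmem
  simp only [cancelLen] at this ⊢
  omega

theorem isRedSeq_actSeq {m : ℕ} (g : FreeGroup (Fin m)) (ω : Boundary m) :
    IsRedSeq (actSeq g ω) := by
  intro n
  obtain ⟨hkle, hcan⟩ := cancelLen_spec g.toWord ω.1
  by_cases h1 : n + 1 < g.toWord.length - cancelLen g.toWord ω.1
  · have h0 : n < g.toWord.length - cancelLen g.toWord ω.1 := by omega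
    rw [show actSeq g ω (n + 1) = g.toWord[n + 1]'(by omega) from dif_pos h1,
        show actSeq g ω n = g.toWord[n]'(by omega) from dif_pos h0]
    exact toWord_chain g (by omega)
  · by_cases h0 : n < g.toWord.length - cancelLen g.toWord ω.1
    · have hklt : cancelLen g.toWord ω.1 < g.toWord.length := by omega
      have hidx : n = g.toWord.length - 1 - cancelLen g.toWord ω.1 := by omega
      have e0 : actSeq g ω n = g.toWord[n]'(by omega) := dif_pos h0
      have e1 : actSeq g ω (n + 1) =
          ω.1 (n + 1 - (g.toWord.length - cancelLen g.toWord ω.1) +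
            cancelLen g.toWord ω.1) := dif_neg h1
      have harg : n + 1 - (g.toWord.length - cancelLen g.toWord ω.1) +
          cancelLen g.toWord ω.1 = cancelLen g.toWord ω.1 := by omega
      rw [harg] at e1
      rw [e0, e1]
      intro hcon
      apply cancelLen_max g.toWord ω.1 hklt
      subst hidx
      rw [List.getElem?_eq_getElem (by omega), hcon, linv_linv]
    · have e0 : actSeq g ω n =
          ω.1 (n - (g.toWord.length - cancelLen g.toWord ω.1) +
            cancelLen g.toWord ω.1) := dif_neg h0
      have e1 : actSeq g ω (n + 1) =
          ω.1 (n + 1 - (g.toWord.length - cancelLen g.toWord ω.1) +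
            cancelLen g.toWord ω.1) := dif_neg (by omega)
      have harg : n + 1 - (g.toWord.length - cancelLen g.toWord ω.1) +
          cancelLen g.toWord ω.1 =
          (n - (g.toWord.length - cancelLen g.toWord ω.1) + cancelLen g.toWord ω.1) + 1 := by
        omega
      rw [e0, e1, harg]
      exact ω.2 _

/-- The boundary action of `F` on `∂F`: `g · ω` is the free reduction of the
concatenation of the reduced word of `g` with `ω`. -/
def bact {m : ℕ} (g : FreeGroup (Fin m)) (ω : Boundary m) : Boundary m :=
  ⟨actSeq g ω, isRedSeq_actSeq g ω⟩


/-- The Schreier-graph distance from the basepoint: for a right coset `Hg`,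
`normX H x = min { |hg| : h ∈ H }`. -/
def normX {m : ℕ} (H : Subgroup (FreeGroup (Fin m)))
    (x : Quotient (QuotientGroup.rightRel H)) : ℕ :=
  sInf {n | ∃ g : FreeGroup (Fin m), Quotient.mk (QuotientGroup.rightRel H) g = x ∧ wlen g = n}

theorem trunc_succ {m : ℕ} (ω : Boundary m) (n : ℕ) :
    trunc ω (n + 1) = trunc ω n * FreeGroup.mk [ω.1 n] := by
  rw [trunc, trunc, FreeGroup.mul_mk, List.ofFn_succ', List.concat_eq_append]
  rfl

theorem toWord_trunc {m : ℕ} (ω : Boundary m) (n : ℕ) :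
    (trunc ω n).toWord = List.ofFn fun i : Fin n => ω.1 i := by
  rw [trunc, FreeGroup.toWord_mk]
  apply FreeGroup.IsReduced.reduce_eq
  rw [FreeGroup.IsReduced, List.isChain_iff_getElem]
  intro i hi h
  simp only [List.getElem_ofFn] at h ⊢
  have h1 := ω.2 i
  by_contra h2
  apply h1
  refine Prod.ext h.symm ?_
  simp only [linv]
  cases hb : (ω.1 i).2 <;> cases hc : (ω.1 (i + 1)).2 <;> simp_all

theorem wlen_trunc {m : ℕ} (ω : Boundary m) (n : ℕ) : wlen (trunc ω n) = n := by
  simp [wlen, toWord_trunc]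

theorem trunc_eq_iff {m : ℕ} (ω ω' : Boundary m) (n : ℕ) :
    trunc ω n = trunc ω' n ↔ ∀ i < n, ω.1 i = ω'.1 i := by
  rw [← FreeGroup.toWord_inj, toWord_trunc, toWord_trunc, List.ofFn_inj, funext_iff]
  exact ⟨fun h i hi => h ⟨i, hi⟩, fun h i => h i i.2⟩

/-- The second point is obtained from the first by the prefix replacement that left multiplication
by `g` performs. -/
def IsTranslate {m : ℕ} (g : FreeGroup (Fin m)) (ω ω' : Boundary m) : Prop :=
  ∃ a b, trunc ω' a = g * trunc ω b ∧ ∀ k, ω'.1 (a + k) = ω.1 (b + k)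

theorem trunc_add_eq_mul {m : ℕ} {g : FreeGroup (Fin m)} {ω ω' : Boundary m} {a b : ℕ}
    (h : trunc ω' a = g * trunc ω b) (h' : ∀ k, ω'.1 (a + k) = ω.1 (b + k)) (k : ℕ) :
    trunc ω' (a + k) = g * trunc ω (b + k) := by
  induction k with
  | zero => exact h
  | succ k ih => rw [← add_assoc, ← add_assoc, trunc_succ, trunc_succ, ih, h', mul_assoc]

theorem IsTranslate.unique {m : ℕ} {g : FreeGroup (Fin m)} {ω ω₁ ω₂ : Boundary m}
    (h₁ : IsTranslate g ω ω₁) (h₂ : IsTranslate g ω ω₂) : ω₁ = ω₂ := by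
  obtain ⟨a, b, h, h'⟩ := h₁
  obtain ⟨c, d, k, k'⟩ := h₂
  have key : ∀ j, trunc ω₁ (a + (d + j)) = trunc ω₂ (c + (b + j)) := fun j => by
    rw [trunc_add_eq_mul h h', trunc_add_eq_mul k k']
    congr 2
    omega
  have hl : a + d = c + b := by
    have := congrArg wlen (key 0)
    simpa [wlen_trunc] using this
  refine Subtype.ext (funext fun i => ?_)
  have := key (i + 1)
  rw [show c + (b + (i + 1)) = a + (d + (i + 1)) by omega, trunc_eq_iff] at this
  exact this i (by omega)

theorem IsTranslate.comp {m : ℕ} {g g' : FreeGroup (Fin m)} {ω ω' ω'' : Boundary m}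
    (h : IsTranslate g ω ω') (h' : IsTranslate g' ω' ω'') : IsTranslate (g' * g) ω ω'' := by
  obtain ⟨a, b, h, k⟩ := h
  obtain ⟨c, d, h', k'⟩ := h'
  refine ⟨c + a, b + d, ?_, fun j => ?_⟩
  · rw [trunc_add_eq_mul h' k', add_comm d a, trunc_add_eq_mul h k, mul_assoc]
  · rw [add_assoc, k', add_assoc, ← k, show a + (d + j) = d + (a + j) by omega]

theorem mul_trunc_eq_mk_take {m : ℕ} (g : FreeGroup (Fin m)) (ω : Boundary m) (j : ℕ)
    (hj : j ≤ cancelLen g.toWord ω.1) :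
    g * trunc ω j = FreeGroup.mk (g.toWord.take (g.toWord.length - j)) := by
  obtain ⟨hle, hc⟩ := cancelLen_spec g.toWord ω.1
  induction j with
  | zero => simp [trunc, FreeGroup.mk_toWord, ← FreeGroup.one_eq_mk]
  | succ j ih =>
    have hget := hc j (by omega)
    rw [trunc_succ, ← mul_assoc, ih (by omega),
      show g.toWord.length - j = g.toWord.length - 1 - j + 1 by omega, List.take_add_one, hget,
      show g.toWord.length - (j + 1) = g.toWord.length - 1 - j by omega, Option.toList_some,
      FreeGroup.mul_mk]
    apply Quot.sound
    have := @FreeGroup.Red.Step.not _ (g.toWord.take (g.toWord.length - 1 - j)) []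
      (ω.1 j).1 (!(ω.1 j).2)
    simpa [linv] using this

theorem isTranslate_bact {m : ℕ} (g : FreeGroup (Fin m)) (ω : Boundary m) :
    IsTranslate g ω (bact g ω) := by
  obtain ⟨hle, -⟩ := cancelLen_spec g.toWord ω.1
  refine ⟨g.toWord.length - cancelLen g.toWord ω.1, cancelLen g.toWord ω.1, ?_, fun k => ?_⟩
  · rw [mul_trunc_eq_mk_take g ω _ le_rfl, trunc]
    congr 1
    apply List.ext_getElem
    · simp
    · intro i h1 h2
      simp only [List.length_ofFn] at h1
      simp [bact, actSeq]
  · simp only [bact, actSeq]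
    rw [dif_neg (by omega), Nat.add_sub_cancel_left, add_comm]

theorem bact_inv_bact {m : ℕ} (g : FreeGroup (Fin m)) (ω : Boundary m) :
    bact g⁻¹ (bact g ω) = ω := by
  have h := (isTranslate_bact g ω).comp (isTranslate_bact g⁻¹ (bact g ω))
  rw [inv_mul_cancel] at h
  exact h.unique ⟨0, 0, by simp, fun _ => rfl⟩

theorem bact_bact_inv {m : ℕ} (g : FreeGroup (Fin m)) (ω : Boundary m) :
    bact g (bact g⁻¹ ω) = ω := by
  simpa using bact_inv_bact g⁻¹ ω

theorem bact_injective {m : ℕ} (g : FreeGroup (Fin m)) : Function.Injective (bact g) :=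
  Function.LeftInverse.injective (bact_inv_bact g)

theorem image_bact {m : ℕ} (g : FreeGroup (Fin m)) (W : Set (Boundary m)) :
    bact g '' W = bact g⁻¹ ⁻¹' W :=
  congrFun (Set.image_eq_preimage_of_inverse (bact_inv_bact g) (bact_bact_inv g)) W

theorem measurable_letter {m : ℕ} (i : ℕ) : Measurable fun ω : Boundary m => ω.1 i :=
  (measurable_pi_apply i).comp measurable_subtype_coe

theorem measurable_of_eq_of_prefix {m : ℕ} {f : Boundary m → Letter m} (N : ℕ)
    (hf : ∀ ω ω' : Boundary m, (∀ i < N, ω.1 i = ω'.1 i) → f ω = f ω') : Measurable f := by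
  have hr : Measurable fun (ω : Boundary m) (i : Fin N) => ω.1 i :=
    measurable_pi_lambda _ fun i => measurable_letter i
  refine measurable_to_countable' fun x => ?_
  have : f ⁻¹' {x} = (fun (ω : Boundary m) (i : Fin N) => ω.1 i) ⁻¹'
      ((fun (ω : Boundary m) (i : Fin N) => ω.1 i) '' (f ⁻¹' {x})) := by
    refine Set.Subset.antisymm (Set.subset_preimage_image _ _) ?_
    rintro ω ⟨ω', h1, h2⟩
    exact (hf ω ω' fun i hi => (congrFun h2 ⟨i, hi⟩).symm).trans h1
  rw [this]
  exact hr (Set.toFinite _).measurableSet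

theorem cancelLen_congr {m : ℕ} {w : List (Letter m)} {ω ω' : ℕ → Letter m}
    (h : ∀ i < w.length, ω i = ω' i) : cancelLen w ω = cancelLen w ω' := by
  unfold cancelLen
  congr 1
  ext k
  refine and_congr_right fun hk => forall₂_congr fun i hi => ?_
  rw [h i (by omega)]

theorem measurable_bact {m : ℕ} (g : FreeGroup (Fin m)) : Measurable (bact g) := by
  refine Measurable.subtype_mk (measurable_pi_lambda _ fun n => ?_)
  refine measurable_of_eq_of_prefix (g.toWord.length + n + 1) fun ω ω' h => ?_
  have hc : cancelLen g.toWord ω.1 = cancelLen g.toWord ω'.1 :=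
    cancelLen_congr fun i hi => h i (by omega)
  have hle := (cancelLen_spec g.toWord ω'.1).1
  unfold actSeq
  simp only [hc]
  split_ifs
  · rfl
  · exact h _ (by omega)

/-- The boundary points sharing their first `n` letters with `γ`. -/
def prefixSet {m : ℕ} (n : ℕ) (γ : Boundary m) : Set (Boundary m) :=
  {ω | ∀ i < n, ω.1 i = γ.1 i}

theorem measurableSet_prefixSet {m : ℕ} (n : ℕ) (γ : Boundary m) :
    MeasurableSet (prefixSet n γ) := by
  simp only [prefixSet, Set.ofPred_forall]
  refine MeasurableSet.iInter fun i => MeasurableSet.iInter fun _ => ?_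
  exact measurable_letter i (measurableSet_singleton (γ.1 i))

theorem prefixSet_inter {m : ℕ} {k l : ℕ} {γ γ' δ : Boundary m} (h : δ ∈ prefixSet k γ)
    (h' : δ ∈ prefixSet l γ') : prefixSet k γ ∩ prefixSet l γ' = prefixSet (max k l) δ := by
  ext ω
  simp only [prefixSet, Set.mem_inter_iff, Set.mem_ofPred_eq] at *
  constructor
  · rintro ⟨h1, h2⟩ i hi
    rcases lt_max_iff.mp hi with hi | hi
    · rw [h1 i hi, h i hi]
    · rw [h2 i hi, h' i hi]
  · intro h1
    exact ⟨fun i hi => (h1 i (by omega)).trans (h i hi),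
      fun i hi => (h1 i (by omega)).trans (h' i hi)⟩

theorem prefixSet_eq_cylinder {m : ℕ} (n : ℕ) (γ : Boundary m) :
    prefixSet n γ = _root_.cylinder (trunc γ n) := by
  ext ω
  simp [prefixSet, _root_.cylinder, wlen_trunc, trunc_eq_iff]

theorem generateFrom_prefixSet (m : ℕ) :
    (inferInstance : MeasurableSpace (Boundary m)) =
      MeasurableSpace.generateFrom {s | s = ∅ ∨ ∃ n γ, s = prefixSet n γ} := by
  apply le_antisymm
  · have key : @Measurable (Boundary m) (ℕ → Letter m)
        (MeasurableSpace.generateFrom {s | s = ∅ ∨ ∃ n γ, s = prefixSet n γ}) _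
        Subtype.val := by
      refine @measurable_pi_lambda _ _ _ (_) _ _ fun n => ?_
      refine @measurable_to_countable' _ _ (_) _ (_) _ fun x => ?_
      have : (fun ω : Boundary m => ω.1 n) ⁻¹' {x} =
          ⋃ f ∈ {f : Fin (n + 1) → Letter m | f (Fin.last n) = x},
            {ω : Boundary m | (fun i : Fin (n + 1) => ω.1 i) = f} := by
        ext ω
        simp
      rw [this]
      refine @Set.Finite.measurableSet_biUnion _ _ (_) _ _ (Set.toFinite _) fun f _ => ?_
      apply MeasurableSpace.measurableSet_generateFrom
      rcases Set.eq_empty_or_nonempty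
        {ω : Boundary m | (fun i : Fin (n + 1) => ω.1 i) = f} with h | ⟨γ, hγ⟩
      · exact Or.inl h
      · refine Or.inr ⟨n + 1, γ, ?_⟩
        ext ω
        rw [Set.mem_ofPred_eq] at hγ
        rw [Set.mem_ofPred_eq, ← hγ, funext_iff]
        exact ⟨fun h i hi => h ⟨i, hi⟩, fun h i => h i i.2⟩
    exact key.comap_le
  · refine MeasurableSpace.generateFrom_le ?_
    rintro s (rfl | ⟨n, γ, rfl⟩)
    · exact MeasurableSet.empty
    · exact measurableSet_prefixSet n γ

theorem isPiSystem_prefixSet (m : ℕ) :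
    IsPiSystem {s : Set (Boundary m) | s = ∅ ∨ ∃ n γ, s = prefixSet n γ} := by
  rintro s (rfl | ⟨n, γ, rfl⟩) t (rfl | ⟨n', γ', rfl⟩) ⟨δ, h, h'⟩
  · exact h.elim
  · exact h.elim
  · exact h'.elim
  · exact Or.inr ⟨_, δ, prefixSet_inter h h'⟩

/-- The group element carrying the length-`n` prefix of `α` to that of `β`. -/
def prefixSwap {m : ℕ} (n : ℕ) (α β : Boundary m) : FreeGroup (Fin m) :=
  trunc β n * (trunc α n)⁻¹

theorem prefixSwap_inv {m : ℕ} (n : ℕ) (α β : Boundary m) :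
    (prefixSwap n α β)⁻¹ = prefixSwap n β α := by
  simp [prefixSwap]

theorem bact_prefixSwap {m : ℕ} {n : ℕ} {α β ω : Boundary m} (h : α.1 n = β.1 n)
    (hω : ω ∈ prefixSet (n + 1) α) (i : ℕ) :
    (bact (prefixSwap (n + 1) α β) ω).1 i = if i < n + 1 then β.1 i else ω.1 i := by
  let ω' : Boundary m := ⟨fun i => if i < n + 1 then β.1 i else ω.1 i, fun i => by
    rcases lt_trichotomy i n with hi | rfl | hi
    · simpa [show i < n + 1 by omega, hi] using β.2 i
    · simpa [← h, ← hω i (by omega)] using ω.2 i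
    · simpa [show ¬ i < n + 1 by omega, show ¬ i < n by omega] using ω.2 i⟩
  have hT : IsTranslate (prefixSwap (n + 1) α β) ω ω' := by
    refine ⟨n + 1, n + 1, ?_, fun k => ?_⟩
    · rw [(trunc_eq_iff ω α (n + 1)).2 hω, prefixSwap, inv_mul_cancel_right, trunc_eq_iff]
      intro i hi
      simp [ω', hi]
    · simp only [ω']
      rw [if_neg (by omega)]
  rw [(isTranslate_bact _ _).unique hT]

theorem bact_mem_prefixSet {m : ℕ} {n k : ℕ} {α β δ ω : Boundary m} (h : α.1 n = β.1 n)
    (hk : n + 1 ≤ k) (hδ : δ ∈ prefixSet (n + 1) α) (hω : ω ∈ prefixSet k δ) :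
    bact (prefixSwap (n + 1) α β) ω ∈
      prefixSet k (bact (prefixSwap (n + 1) α β) δ) := by
  have hω' : ω ∈ prefixSet (n + 1) α := fun i hi => (hω i (by omega)).trans (hδ i hi)
  intro i hi
  rw [bact_prefixSwap h hδ, bact_prefixSwap h hω', hω i hi]

theorem preimage_bact_prefixSet {m : ℕ} {n k : ℕ} {α β δ : Boundary m} (h : α.1 n = β.1 n)
    (hk : n + 1 ≤ k) (hδ : δ ∈ prefixSet (n + 1) α) :
    bact (prefixSwap (n + 1) β α) ⁻¹' prefixSet k δ =
      prefixSet k (bact (prefixSwap (n + 1) α β) δ) := by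
  rw [← prefixSwap_inv, ← image_bact]
  refine Set.Subset.antisymm ?_ ?_
  · rintro _ ⟨ω, hω, rfl⟩
    exact bact_mem_prefixSet h hk hδ hω
  · intro ω hω
    rw [image_bact, prefixSwap_inv, Set.mem_preimage]
    have hδ' : bact (prefixSwap (n + 1) α β) δ ∈ prefixSet (n + 1) β := fun i hi => by
      rw [bact_prefixSwap h hδ, if_pos hi]
    have := bact_mem_prefixSet h.symm hk hδ' hω
    rwa [← prefixSwap_inv n.succ α β, bact_inv_bact, prefixSwap_inv] at this

theorem measure_image_bact_prefixSwap {m : ℕ} {μ : Measure (Boundary m)} [IsFiniteMeasure μ]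
    {s : ℕ → ℝ≥0∞} (hs : ∀ k γ, μ (prefixSet (k + 1) γ) = s k) {n : ℕ} {α β : Boundary m}
    (h : α.1 n = β.1 n) {A : Set (Boundary m)} (hA : MeasurableSet A)
    (hAα : A ⊆ prefixSet (n + 1) α) :
    μ (bact (prefixSwap (n + 1) α β) '' A) = μ A := by
  have hmeas := measurable_bact (prefixSwap (n + 1) β α)
  have key : ∀ k, n + 1 ≤ k → ∀ δ ∈ prefixSet (n + 1) α,
      μ.map (bact (prefixSwap (n + 1) β α)) (prefixSet k δ) = μ (prefixSet k δ) := by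
    intro k hk δ hδ
    rw [Measure.map_apply hmeas (measurableSet_prefixSet k δ), preimage_bact_prefixSet h hk hδ]
    obtain ⟨k, rfl⟩ : ∃ j, k = j + 1 := ⟨k - 1, by omega⟩
    rw [hs, hs]
  have hrestr : μ.restrict (prefixSet (n + 1) α) =
      (μ.map (bact (prefixSwap (n + 1) β α))).restrict (prefixSet (n + 1) α) := by
    refine ext_of_generate_finite _ (generateFrom_prefixSet m) (isPiSystem_prefixSet m) ?_ ?_
    · rintro t (rfl | ⟨k, γ, rfl⟩)
      · simp
      · rw [Measure.restrict_apply (measurableSet_prefixSet k γ),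
          Measure.restrict_apply (measurableSet_prefixSet k γ)]
        rcases Set.eq_empty_or_nonempty (prefixSet k γ ∩ prefixSet (n + 1) α) with he | ⟨δ, h1, h2⟩
        · simp [he]
        · rw [prefixSet_inter h1 h2, key _ (le_max_right _ _) δ h2]
    · rw [Measure.restrict_apply_univ, Measure.restrict_apply_univ,
        key _ le_rfl α fun _ _ => rfl]
  have h2 := congrArg (fun ν : Measure (Boundary m) => ν A) hrestr
  simp only [Measure.restrict_apply hA, Set.inter_eq_left.2 hAα] at h2
  rw [h2, Measure.map_apply hmeas hA, image_bact, prefixSwap_inv]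

theorem sq_sum_le_card_mul_of_sum_pairs_le_one {ι κ : Type*} [Fintype ι] [Fintype κ]
    [DecidableEq κ] (c : ι → κ) (a : ι → ℝ) (s : ℝ) (hs : 0 ≤ s) (ha : ∀ i, 0 ≤ a i)
    (has : ∀ i, a i ≤ s)
    (hpairs : ∑ p : ι × ι with c p.1 = c p.2 ∧ a p.1 ≠ 0 ∧ a p.2 ≠ 0, a p.1 ≤ 1) :
    (∑ i, a i) ^ 2 ≤ Fintype.card κ * s := by
  have hfib : ∑ i, a i = ∑ x, ∑ i, if c i = x then a i else 0 := by
    rw [Finset.sum_comm]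
    simp
  have hsq : ∑ x, (∑ i, if c i = x then a i else 0) ^ 2 =
      ∑ p : ι × ι, if c p.1 = c p.2 then a p.1 * a p.2 else 0 := by
    simp_rw [sq, Finset.sum_mul_sum, Fintype.sum_prod_type]
    rw [Finset.sum_comm]
    refine Finset.sum_congr rfl fun i _ => ?_
    rw [Finset.sum_comm]
    refine Finset.sum_congr rfl fun j _ => ?_
    simp [ite_mul, eq_comm]
  have hle : ∑ p : ι × ι, (if c p.1 = c p.2 then a p.1 * a p.2 else 0) ≤
      (∑ p : ι × ι with c p.1 = c p.2 ∧ a p.1 ≠ 0 ∧ a p.2 ≠ 0, a p.1) * s := by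
    rw [Finset.sum_mul, Finset.sum_filter]
    refine Finset.sum_le_sum fun p _ => ?_
    by_cases h1 : c p.1 = c p.2 <;> by_cases h2 : a p.1 = 0 <;> by_cases h3 : a p.2 = 0 <;>
      simp [h1, h2, h3]
    exact mul_le_mul_of_nonneg_left (has _) (ha _)
  calc (∑ i, a i) ^ 2 ≤ Fintype.card κ * ∑ x, (∑ i, if c i = x then a i else 0) ^ 2 := by
        rw [hfib]
        exact sq_sum_le_card_mul_sum_sq
    _ ≤ Fintype.card κ * s := by
        rw [hsq]
        refine mul_le_mul_of_nonneg_left (hle.trans ?_) (Nat.cast_nonneg _)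
        exact mul_le_of_le_one_left hs hpairs

theorem normX_mk_le {m : ℕ} (H : Subgroup (FreeGroup (Fin m))) (g : FreeGroup (Fin m)) :
    normX H (Quotient.mk (QuotientGroup.rightRel H) g) ≤ wlen g :=
  Nat.sInf_le ⟨g, rfl, rfl⟩

theorem exists_wlen_eq_normX {m : ℕ} (H : Subgroup (FreeGroup (Fin m)))
    (x : Quotient (QuotientGroup.rightRel H)) :
    ∃ g : FreeGroup (Fin m), Quotient.mk (QuotientGroup.rightRel H) g = x ∧
      wlen g = normX H x := by
  obtain ⟨g, rfl⟩ := Quotient.exists_rep x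
  exact Nat.sInf_mem (s := {n | ∃ g' : FreeGroup (Fin m),
    Quotient.mk (QuotientGroup.rightRel H) g' = Quotient.mk _ g ∧ wlen g' = n}) ⟨_, g, rfl, rfl⟩

theorem exists_ball_injective {m : ℕ} (H : Subgroup (FreeGroup (Fin m))) (n : ℕ) :
    ∃ f : {x : Quotient (QuotientGroup.rightRel H) // normX H x ≤ n} →
      (Fin n → Option (Letter m)), Function.Injective f := by
  choose g hg hw using exists_wlen_eq_normX H
  refine ⟨fun x i => (g x).toWord[i]?, fun x y h => Subtype.ext ?_⟩
  rw [← hg x, ← hg y]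
  congr 1
  refine FreeGroup.toWord_injective (List.ext_getElem? fun i => ?_)
  by_cases hi : i < n
  · exact congrFun h ⟨i, hi⟩
  · have hx : (g x).toWord.length ≤ n := (hw x).le.trans x.2
    have hy : (g y).toWord.length ≤ n := (hw y).le.trans y.2
    rw [List.getElem?_eq_none (by omega), List.getElem?_eq_none (by omega)]

theorem finite_ball {m : ℕ} (H : Subgroup (FreeGroup (Fin m))) (n : ℕ) :
    Finite {x : Quotient (QuotientGroup.rightRel H) // normX H x ≤ n} := by
  obtain ⟨f, hf⟩ := exists_ball_injective H n
  exact Finite.of_injective f hf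

theorem card_ball_le {m : ℕ} (H : Subgroup (FreeGroup (Fin m))) (n : ℕ) :
    Nat.card {x : Quotient (QuotientGroup.rightRel H) // normX H x ≤ n} ≤ (2 * m + 1) ^ n := by
  obtain ⟨f, hf⟩ := exists_ball_injective H n
  refine (Nat.card_le_card_of_injective f hf).trans_eq ?_
  simp [mul_comm]

theorem sq_measureReal_le_card_ball {m : ℕ} {μ : Measure (Boundary m)} [IsProbabilityMeasure μ]
    {s : ℕ → ℝ≥0∞} (hs : ∀ k γ, μ (prefixSet (k + 1) γ) = s k)
    (H : Subgroup (FreeGroup (Fin m))) {W : Set (Boundary m)} (hW : MeasurableSet W)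
    (hwand : ∀ h h' : H, h ≠ h' →
      μ (bact (h : FreeGroup (Fin m)) '' W ∩ bact (h' : FreeGroup (Fin m)) '' W) = 0) (n : ℕ) :
    μ.real W ^ 2 ≤
      Nat.card {x : Quotient (QuotientGroup.rightRel H) // normX H x ≤ n + 1} * (2 * m) *
        (s n).toReal := by
  classical
  have : Finite {x : Quotient (QuotientGroup.rightRel H) // normX H x ≤ n + 1} :=
    finite_ball H (n + 1)
  have := Fintype.ofFinite {x : Quotient (QuotientGroup.rightRel H) // normX H x ≤ n + 1}
  have : Nonempty (Boundary m) := μ.nonempty_of_neZero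
  let r : Boundary m → Fin (n + 1) → Letter m := fun ω i => ω.1 i
  have hr : Measurable r := measurable_pi_lambda _ fun i => measurable_letter i
  let pt : (Fin (n + 1) → Letter m) → Boundary m := Function.invFun r
  let a : (Fin (n + 1) → Letter m) → ℝ := fun f => μ.real (W ∩ r ⁻¹' {f})
  have hrange : ∀ f, a f ≠ 0 → r (pt f) = f := by
    intro f hf
    have hne : (W ∩ r ⁻¹' {f}).Nonempty := by
      by_contra hcon
      exact hf (by simp [a, Set.not_nonempty_iff_eq_empty.1 hcon])
    obtain ⟨ω, -, hω⟩ := hne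
    exact Function.invFun_eq ⟨ω, hω⟩
  have hfiber : ∀ f, a f ≠ 0 → r ⁻¹' {f} = prefixSet (n + 1) (pt f) := by
    intro f hf
    ext ω
    rw [Set.mem_preimage, Set.mem_singleton_iff]
    conv_lhs => rw [← hrange f hf, funext_iff]
    exact ⟨fun h i hi => h ⟨i, hi⟩, fun h i => h i i.2⟩
  have htrunc : ∀ f, a f ≠ 0 → trunc (pt f) (n + 1) = FreeGroup.mk (List.ofFn f) := by
    intro f hf
    conv_rhs => rw [← hrange f hf]
    rfl
  have hlen (f : Fin (n + 1) → Letter m) :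
      normX H (Quotient.mk _ (FreeGroup.mk (List.ofFn f))) ≤ n + 1 :=
    (normX_mk_le H _).trans (FreeGroup.norm_mk_le.trans_eq (by simp))
  let c : (Fin (n + 1) → Letter m) →
      {x : Quotient (QuotientGroup.rightRel H) // normX H x ≤ n + 1} × Letter m :=
    fun f => (⟨Quotient.mk _ (FreeGroup.mk (List.ofFn f)), hlen f⟩, f (Fin.last n))
  have hmem : ∀ f f', a f ≠ 0 → a f' ≠ 0 → c f = c f' →
      prefixSwap (n + 1) (pt f) (pt f') ∈ H := by
    intro f f' hf hf' hc
    rw [prefixSwap, htrunc f hf, htrunc f' hf']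
    exact QuotientGroup.rightRel_apply.1 (Quotient.exact (Subtype.ext_iff.1 (Prod.ext_iff.1 hc).1))
  have hlast : ∀ f f', a f ≠ 0 → a f' ≠ 0 → c f = c f' → (pt f).1 n = (pt f').1 n := by
    intro f f' hf hf' hc
    have h1 := congrFun (hrange f hf) (Fin.last n)
    have h2 := congrFun (hrange f' hf') (Fin.last n)
    exact h1.trans ((Prod.ext_iff.1 hc).2.trans h2.symm)
  have hsum : μ.real W = ∑ f, a f := by
    have := sum_measureReal_preimage_singleton (μ := μ.restrict W) (Finset.univ)
      (f := r) (fun y _ => hr (measurableSet_singleton y))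
    rw [Finset.coe_univ, Set.preimage_univ, measureReal_restrict_apply_univ] at this
    rw [← this]
    refine Finset.sum_congr rfl fun f _ => ?_
    rw [measureReal_restrict_apply (hr (measurableSet_singleton f)), Set.inter_comm]
  have has : ∀ f, a f ≤ (s n).toReal := by
    intro f
    by_cases hf : a f = 0
    · rw [hf]
      exact ENNReal.toReal_nonneg
    · rw [← hs n (pt f), ← hfiber f hf]
      exact measureReal_mono Set.inter_subset_right
  have hpieces : ∀ f, MeasurableSet (W ∩ r ⁻¹' {f}) := fun f =>
    hW.inter (hr (measurableSet_singleton f))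
  have hpairs : ∑ p : (Fin (n + 1) → Letter m) × (Fin (n + 1) → Letter m)
      with c p.1 = c p.2 ∧ a p.1 ≠ 0 ∧ a p.2 ≠ 0, a p.1 ≤ 1 := by
    let E : (Fin (n + 1) → Letter m) × (Fin (n + 1) → Letter m) → Set (Boundary m) := fun p =>
      bact (prefixSwap (n + 1) (pt p.1) (pt p.2)) '' (W ∩ r ⁻¹' {p.1})
    have hE : ∀ p : (Fin (n + 1) → Letter m) × (Fin (n + 1) → Letter m),
        c p.1 = c p.2 ∧ a p.1 ≠ 0 ∧ a p.2 ≠ 0 → μ.real (E p) = a p.1 := by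
      rintro ⟨f, f'⟩ ⟨hc, hf, hf'⟩
      refine congrArg ENNReal.toReal (measure_image_bact_prefixSwap hs
        (hlast f f' hf hf' hc) (hpieces f) ?_)
      rw [hfiber f hf]
      exact Set.inter_subset_right
    have hEmeas : ∀ p, MeasurableSet (E p) := by
      intro p
      simp only [E, image_bact]
      exact measurable_bact _ (hpieces p.1)
    calc _ = ∑ p : (Fin (n + 1) → Letter m) × (Fin (n + 1) → Letter m)
          with c p.1 = c p.2 ∧ a p.1 ≠ 0 ∧ a p.2 ≠ 0, μ.real (E p) :=
          Finset.sum_congr rfl fun p hp => (hE p (Finset.mem_filter.1 hp).2).symm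
      _ = μ.real (⋃ p ∈ Finset.univ.filter
          (fun p : (Fin (n + 1) → Letter m) × (Fin (n + 1) → Letter m) =>
            c p.1 = c p.2 ∧ a p.1 ≠ 0 ∧ a p.2 ≠ 0), E p) := by
          refine (measureReal_biUnion_finset₀ ?_ fun p _ => (hEmeas p).nullMeasurableSet).symm
          rintro ⟨f, f'⟩ hp ⟨g, g'⟩ hq hpq
          obtain ⟨-, hc, hf, hf'⟩ := Finset.mem_filter.1 (Finset.mem_coe.1 hp)
          obtain ⟨-, hc', hg, hg'⟩ := Finset.mem_filter.1 (Finset.mem_coe.1 hq)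
          simp only at hc hf hf' hc' hg hg'
          by_cases heq : prefixSwap (n + 1) (pt f) (pt f') = prefixSwap (n + 1) (pt g) (pt g')
          · have hfg : f ≠ g := by
              rintro rfl
              rw [prefixSwap, prefixSwap, mul_left_inj, trunc_eq_iff] at heq
              apply hpq
              rw [← hrange f' hf', ← hrange g' hg']
              exact congrArg _ (funext fun i => heq i i.2)
            refine Disjoint.aedisjoint ?_
            simp only [E, heq]
            rw [Set.disjoint_image_iff (bact_injective _)]
            exact (Disjoint.preimage r (by simpa using hfg)).mono Set.inter_subset_right
              Set.inter_subset_right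
          · refine measure_mono_null (Set.inter_subset_inter
              (Set.image_mono Set.inter_subset_left) (Set.image_mono Set.inter_subset_left))
              (hwand ⟨_, hmem f f' hf hf' hc⟩ ⟨_, hmem g g' hg hg' hc'⟩ ?_)
            simpa using heq
      _ ≤ 1 := measureReal_le_one
  have := sq_sum_le_card_mul_of_sum_pairs_le_one c a _ ENNReal.toReal_nonneg
    (fun f => measureReal_nonneg) has hpairs
  rw [← hsum] at this
  refine this.trans_eq ?_
  simp [Nat.card_eq_fintype_card, mul_comm]

theorem isBoundedUnder_card_ball {m : ℕ} (H : Subgroup (FreeGroup (Fin m))) :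
    IsBoundedUnder (· ≤ ·) atTop fun n : ℕ =>
      (Nat.card {x : Quotient (QuotientGroup.rightRel H) // normX H x ≤ n} : ℝ)
        ^ ((n : ℝ)⁻¹) := by
  refine isBoundedUnder_of_eventually_le (a := ((2 * m + 1 : ℕ) : ℝ)) ?_
  filter_upwards [eventually_ne_atTop 0] with n hn
  rw [← Real.pow_rpow_inv_natCast (Nat.cast_nonneg (2 * m + 1)) hn]
  refine Real.rpow_le_rpow (Nat.cast_nonneg _) ?_ (by positivity)
  exact_mod_cast card_ball_le H n

/-- **Subexponential-growth conservativity criterion.** If the exponential growth rate of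
the Schreier graph satisfies `v_X < 2m - 1`, then the boundary action of `H` is
conservative. -/
theorem conservative_of_schreier_growth_lt (m : ℕ) (hm : 2 ≤ m)
    (μ : Measure (Boundary m)) [IsProbabilityMeasure μ]
    (hμ : ∀ g : FreeGroup (Fin m), g ≠ 1 →
      μ (cylinder g) = ((2 * m * (2 * m - 1) ^ (wlen g - 1) : ℕ) : ℝ≥0∞)⁻¹)
    (H : Subgroup (FreeGroup (Fin m)))
    (hvX : Filter.limsup (fun n : ℕ =>
        (Nat.card {x : Quotient (QuotientGroup.rightRel H) // normX H x ≤ n} : ℝ)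
          ^ ((n : ℝ)⁻¹)) atTop
      < ((2 * m - 1 : ℕ) : ℝ)) :
    ∀ W : Set (Boundary m), MeasurableSet W →
      (∀ h h' : H, h ≠ h' →
        μ (bact (h : FreeGroup (Fin m)) '' W ∩ bact (h' : FreeGroup (Fin m)) '' W) = 0) →
      μ W = 0 := by
  intro W hW hwand
  by_contra hne
  have hs : ∀ k γ, μ (prefixSet (k + 1) γ) = ((2 * m * (2 * m - 1) ^ k : ℕ) : ℝ≥0∞)⁻¹ := by
    intro k γ
    have h1 : trunc γ (k + 1) ≠ 1 := by
      intro h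
      have h2 := wlen_trunc γ (k + 1)
      simp [h, wlen] at h2
    rw [prefixSet_eq_cylinder, hμ _ h1, wlen_trunc, Nat.add_sub_cancel]
  have hδ : 0 < μ.real W := ENNReal.toReal_pos hne (measure_ne_top μ W)
  have hq : (0 : ℝ) < ((2 * m - 1 : ℕ) : ℝ) := by
    exact_mod_cast (by omega : 0 < 2 * m - 1)
  have hm0 : (0 : ℝ) < m := by exact_mod_cast (by omega : 0 < m)
  have hgrow (n : ℕ) : μ.real W ^ 2 * ((2 * m - 1 : ℕ) : ℝ) ^ n ≤
      Nat.card {x : Quotient (QuotientGroup.rightRel H) // normX H x ≤ n + 1} := by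
    have h1 := sq_measureReal_le_card_ball hs H hW hwand n
    rw [ENNReal.toReal_inv, ENNReal.toReal_natCast, Nat.cast_mul, Nat.cast_pow, Nat.cast_mul,
      Nat.cast_two, mul_inv, ← mul_assoc, mul_inv_cancel_right₀ (by positivity),
      ← div_eq_mul_inv, le_div_iff₀ (by positivity)] at h1
    exact h1
  obtain ⟨r, hr, hrq⟩ := exists_between hvX
  have hev := eventually_lt_of_limsup_lt hr (isBoundedUnder_card_ball H)
  have hr0 : 0 < r := by
    obtain ⟨n, hn⟩ := hev.exists
    exact (Real.rpow_nonneg (Nat.cast_nonneg _) _).trans_lt hn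
  have hlim : Tendsto (fun n : ℕ => (r / ((2 * m - 1 : ℕ) : ℝ)) ^ n) atTop (𝓝 0) :=
    tendsto_pow_atTop_nhds_zero_of_lt_one (by positivity) ((div_lt_one hq).2 hrq)
  have hsmall := hlim.eventually_lt_const (show 0 < μ.real W ^ 2 / r by positivity)
  obtain ⟨n, hn, hn'⟩ := (((tendsto_add_atTop_nat 1).eventually hev).and hsmall).exists
  have h2 := pow_lt_pow_left₀ hn (Real.rpow_nonneg (Nat.cast_nonneg _) _) n.succ_ne_zero
  rw [Nat.succ_eq_add_one, Real.rpow_inv_natCast_pow (Nat.cast_nonneg _) n.succ_ne_zero] at h2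
  rw [div_pow, div_lt_div_iff₀ (by positivity) hr0, ← pow_succ] at hn'
  linarith [hgrow n]
end
end

section
/- Let H ≤ F be a subgroup and let v_H = limsup_{n→∞} |{ h ∈ H : |h| ≤ n }|^{1/n} be the exponential growth rate of H inside F (the cogrowth of the Schreier graph of H). If v_H < √(2m−1), then the action of H on (∂F, μ) is completely dissipative: there exists a measurable set W ⊆ ∂F with μ(hW ∩ h′W) = 0 for all h ≠ h′ in H and μ(∂F \ ⋃_{h∈H} h·W) = 0. -/
open MeasureTheory Filter Topology
open scoped ENNReal symmDiff

noncomputable section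

theorem boundary_ext_of_trunc {m : ℕ} {ω ω' : Boundary m}
    (h : ∀ N, ∃ n ≥ N, trunc ω n = trunc ω' n) : ω = ω' := by
  have key : ∀ (ω : Boundary m) n, (trunc ω n).toWord = List.ofFn fun i : Fin n => ω.1 i := by
    intro ω n
    refine ((FreeGroup.reduce.red).sublist.eq_of_length ?_)
    have := wlen_trunc ω n
    rw [wlen, trunc, FreeGroup.toWord_mk] at this
    rw [this, List.length_ofFn]
  refine Subtype.ext (funext fun i => ?_)
  obtain ⟨n, hn, he⟩ := h (i + 1)
  have h2 := congrArg FreeGroup.toWord he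
  rw [key, key, List.ofFn_inj] at h2
  exact congrFun h2 ⟨i, hn⟩

theorem drop_eq_invRev_of_le_cancelLen {m : ℕ} (w : List (Letter m)) (ω : ℕ → Letter m) {j : ℕ}
    (hj : j ≤ cancelLen w ω) :
    w.drop (w.length - j) = FreeGroup.invRev (List.ofFn fun i : Fin j => ω i) := by
  obtain ⟨hle, hc⟩ := cancelLen_spec w ω
  refine List.ext_getElem (by simp; omega) fun i h1 h2 => ?_
  have hi : i < j := by simpa using h2
  have h3 := hc (j - 1 - i) (by omega)
  have h4 : w.length - 1 - (j - 1 - i) = w.length - j + i := by omega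
  rw [h4, List.getElem?_eq_getElem (by omega), Option.some_inj] at h3
  simp [FreeGroup.invRev, h3, linv]

/-- The change of length `|g[ω]ₙ| - n`, for large `n`. -/
def lengthShift {m : ℕ} (g : FreeGroup (Fin m)) (ω : Boundary m) : ℤ :=
  (wlen g : ℤ) - 2 * (cancelLen g.toWord ω.1 : ℤ)

theorem trunc_bact {m : ℕ} (g : FreeGroup (Fin m)) (ω : Boundary m) {n k : ℕ}
    (hn : wlen g ≤ n) (hk : (k : ℤ) = n + lengthShift g ω) :
    trunc (bact g ω) k = g * trunc ω n := by
  have hle := (cancelLen_spec g.toWord ω.1).1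
  have hdrop := drop_eq_invRev_of_le_cancelLen g.toWord ω.1 le_rfl
  rw [wlen] at hn
  simp only [lengthShift, wlen] at hk
  generalize hc : cancelLen g.toWord ω.1 = c at *
  obtain ⟨l, rfl⟩ : ∃ l, n = c + l := ⟨n - c, by omega⟩
  obtain rfl : k = g.toWord.length - c + l := by omega
  have h1 : (List.ofFn fun i : Fin (g.toWord.length - c + l) => (bact g ω).1 i) =
      g.toWord.take (g.toWord.length - c) ++ List.ofFn fun i : Fin l => ω.1 (c + i) := by
    refine List.ext_getElem (by simp) fun i h1 h2 => ?_
    simp only [List.getElem_ofFn, bact, actSeq, hc, List.getElem_append, List.length_take,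
      List.getElem_take]
    by_cases hi : i < g.toWord.length - c
    · rw [dif_pos hi, dif_pos (by rw [min_eq_left (by omega)]; exact hi)]
    · rw [dif_neg hi, dif_neg (by rw [min_eq_left (by omega)]; exact hi)]
      rw [min_eq_left (Nat.sub_le _ _), Nat.add_comm c]
  have h2 : (List.ofFn fun i : Fin (c + l) => ω.1 i) =
      (List.ofFn fun i : Fin c => ω.1 i) ++ List.ofFn fun i : Fin l => ω.1 (c + i) := by
    rw [List.ofFn_add]; rfl
  have h3 : g = FreeGroup.mk (g.toWord.take (g.toWord.length - c)) *
      (FreeGroup.mk (List.ofFn fun i : Fin c => ω.1 i))⁻¹ := by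
    rw [FreeGroup.inv_mk, ← hdrop, FreeGroup.mul_mk, List.take_append_drop, FreeGroup.mk_toWord]
  rw [trunc, trunc, h1, h2, ← FreeGroup.mul_mk, ← FreeGroup.mul_mk]
  conv_rhs => rw [h3]
  group

theorem exists_trunc_index {m : ℕ} (g : FreeGroup (Fin m)) (ω : Boundary m) (N n : ℕ)
    (hn : N + wlen g ≤ n) : ∃ k : ℕ, N ≤ k ∧ (k : ℤ) = n + lengthShift g ω := by
  have hle := (cancelLen_spec g.toWord ω.1).1
  refine ⟨(n + lengthShift g ω).toNat, ?_, ?_⟩ <;> simp only [lengthShift, wlen] at * <;> omega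

theorem lengthShift_mul {m : ℕ} (g h : FreeGroup (Fin m)) (ω : Boundary m) :
    lengthShift (g * h) ω = lengthShift g (bact h ω) + lengthShift h ω := by
  set n := wlen g + wlen h + wlen (g * h)
  obtain ⟨k, hk, hk'⟩ := exists_trunc_index h ω (wlen g) n (by omega)
  obtain ⟨l, -, hl⟩ := exists_trunc_index g (bact h ω) 0 k (by omega)
  obtain ⟨l', -, hl'⟩ := exists_trunc_index (g * h) ω 0 n (by omega)
  have h1 := trunc_bact h ω (by omega) hk'
  have h2 := trunc_bact g (bact h ω) hk hl
  have h3 := trunc_bact (g * h) ω (by omega) hl'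
  rw [h1, ← mul_assoc, ← h3] at h2
  have := congrArg wlen h2
  rw [wlen_trunc, wlen_trunc] at this
  omega

theorem bact_mul {m : ℕ} (g h : FreeGroup (Fin m)) (ω : Boundary m) :
    bact (g * h) ω = bact g (bact h ω) := by
  refine boundary_ext_of_trunc fun N => ?_
  set n := N + wlen g + wlen h + wlen (g * h)
  obtain ⟨k, hk, hk'⟩ := exists_trunc_index h ω (N + wlen g) n (by omega)
  obtain ⟨l, hl0, hl⟩ := exists_trunc_index g (bact h ω) N k (by omega)
  refine ⟨l, hl0, ?_⟩
  rw [trunc_bact (g * h) ω (n := n) (by omega) (by rw [lengthShift_mul]; omega),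
    trunc_bact g (bact h ω) (by omega) hl, trunc_bact h ω (by omega) hk', mul_assoc]

theorem lengthShift_one {m : ℕ} (ω : Boundary m) : lengthShift 1 ω = 0 := by
  have hle := (cancelLen_spec (1 : FreeGroup (Fin m)).toWord ω.1).1
  simp only [FreeGroup.toWord_one, List.length_nil] at hle
  simp only [lengthShift, wlen, FreeGroup.toWord_one, List.length_nil]
  omega

theorem bact_one {m : ℕ} (ω : Boundary m) : bact 1 ω = ω := by
  refine boundary_ext_of_trunc fun N => ⟨N, le_rfl, ?_⟩
  rw [trunc_bact 1 ω (n := N) (by simp [wlen]) (by simp [lengthShift_one]), one_mul]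

theorem lengthShift_pow_of_bact_eq {m : ℕ} {g : FreeGroup (Fin m)} {ω : Boundary m}
    (hg : bact g ω = ω) (n : ℕ) : lengthShift (g ^ n) ω = n * lengthShift g ω := by
  induction n with
  | zero => simp [lengthShift_one]
  | succ n ih => rw [pow_succ, lengthShift_mul, hg, ih]; push_cast; ring

theorem lengthShift_inv_bact {m : ℕ} (g : FreeGroup (Fin m)) (ω : Boundary m) :
    lengthShift g⁻¹ (bact g ω) = -lengthShift g ω := by
  have := lengthShift_mul g⁻¹ g ω
  rw [inv_mul_cancel, lengthShift_one] at this
  omega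

theorem measurable_cancelLen {m : ℕ} (w : List (Letter m)) :
    Measurable fun ω : Boundary m => cancelLen w ω.1 := by
  refine measurable_of_Ici fun k => ?_
  have : (fun ω : Boundary m => cancelLen w ω.1) ⁻¹' Set.Ici k =
      {ω | k ≤ w.length} ∩ ⋂ i : Fin k, {ω | w[w.length - 1 - i]? = some (linv (ω.1 i))} := by
    ext ω
    simp only [Set.mem_preimage, Set.mem_Ici, Set.mem_inter_iff, Set.mem_ofPred_eq, Set.mem_iInter]
    constructor
    · intro hk
      obtain ⟨h1, h2⟩ := cancelLen_spec w ω.1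
      exact ⟨hk.trans h1, fun i => h2 i (i.2.trans_le hk)⟩
    · rintro ⟨h1, h2⟩
      exact le_csSup ⟨w.length, fun x hx => hx.1⟩ ⟨h1, fun i hi => h2 ⟨i, hi⟩⟩
  rw [this]
  refine (MeasurableSet.const _).inter (MeasurableSet.iInter fun i => ?_)
  have hi : Measurable fun ω : Boundary m => ω.1 i :=
    (measurable_pi_apply (i : ℕ)).comp measurable_subtype_coe
  exact hi (MeasurableSet.of_discrete (s := {x | w[w.length - 1 - i]? = some (linv x)}))

theorem measurable_lengthShift {m : ℕ} (g : FreeGroup (Fin m)) :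
    Measurable fun ω : Boundary m => lengthShift g ω := by
  exact (measurable_from_top (f := fun c : ℕ => (wlen g : ℤ) - 2 * (c : ℤ))).comp
    (measurable_cancelLen g.toWord)

theorem measure_lengthShift_le {m : ℕ} (hm : 2 ≤ m)
    (μ : Measure (Boundary m)) [IsProbabilityMeasure μ]
    (hμ : ∀ g : FreeGroup (Fin m), g ≠ 1 →
      μ (_root_.cylinder g) = ((2 * m * (2 * m - 1) ^ (wlen g - 1) : ℕ) : ℝ≥0∞)⁻¹)
    (g : FreeGroup (Fin m)) :
    μ {ω | lengthShift g ω ≤ 0} ≤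
      ENNReal.ofReal ((Real.sqrt ((2 * m - 1 : ℕ) : ℝ))⁻¹ ^ wlen g) := by
  rcases Set.eq_empty_or_nonempty {ω : Boundary m | lengthShift g ω ≤ 0} with h0 | ⟨ω₀, hω₀⟩
  · simp [h0]
  by_cases hg : g = 1
  · subst hg; simpa [wlen] using prob_le_one
  have hlen : 0 < wlen g := by
    rw [wlen, List.length_pos_iff]; simpa [FreeGroup.toWord_eq_nil_iff] using hg
  set k := (wlen g + 1) / 2 with hk
  set p : FreeGroup (Fin m) := (FreeGroup.mk (g.toWord.drop (g.toWord.length - k)))⁻¹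
  have hsub : ∀ ω : Boundary m, lengthShift g ω ≤ 0 → trunc ω k = p := by
    intro ω hω
    rw [lengthShift] at hω
    simp only [p]
    rw [drop_eq_invRev_of_le_cancelLen g.toWord ω.1 (by omega), ← FreeGroup.inv_mk, inv_inv, trunc]
  have hp : wlen p = k := by rw [← hsub ω₀ hω₀, wlen_trunc]
  have hp1 : p ≠ 1 := by
    rintro h
    rw [h] at hp
    simp only [wlen, FreeGroup.toWord_one, List.length_nil] at hp hlen hk
    omega
  have hle : μ {ω | lengthShift g ω ≤ 0} ≤ μ (_root_.cylinder p) :=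
    measure_mono fun ω hω => (show trunc ω (wlen p) = p from hp.symm ▸ hsub ω hω)
  refine hle.trans ?_
  rw [hμ p hp1, hp, inv_pow, ENNReal.ofReal_inv_of_pos (by
    have : (0 : ℝ) < ((2 * m - 1 : ℕ) : ℝ) := by exact_mod_cast (by omega : 0 < 2 * m - 1)
    positivity), ENNReal.inv_le_inv, ENNReal.ofReal_le_iff_le_toReal (ENNReal.natCast_ne_top _),
    ENNReal.toReal_natCast]
  set q := 2 * m - 1 with hq
  have hq1 : (1 : ℝ) ≤ q := by exact_mod_cast (by omega : 1 ≤ q)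
  calc Real.sqrt q ^ wlen g ≤ Real.sqrt q ^ (2 * k) :=
        pow_le_pow_right₀ (Real.one_le_sqrt.mpr hq1) (by omega)
    _ = (q : ℝ) ^ k := by rw [pow_mul, Real.sq_sqrt (by positivity)]
    _ ≤ _ := by
      have : q ^ k ≤ 2 * m * q ^ (k - 1) := by
        obtain ⟨j, hj⟩ : ∃ j, k = j + 1 := ⟨k - 1, by omega⟩
        rw [hj, pow_succ, mul_comm, Nat.add_sub_cancel]
        exact Nat.mul_le_mul_right _ (by omega)
      exact_mod_cast this

theorem injective_word_entries {m : ℕ} (H : Subgroup (FreeGroup (Fin m))) (n : ℕ) :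
    Function.Injective fun (g : {g : FreeGroup (Fin m) // g ∈ H ∧ wlen g ≤ n}) (i : Fin n) =>
      g.1.toWord[(i : ℕ)]? := by
  rintro ⟨g, hg, hgn⟩ ⟨h, hh, hhn⟩ he
  refine Subtype.ext (FreeGroup.toWord_injective (List.ext_getElem? fun i => ?_))
  rw [wlen] at hgn hhn
  by_cases hi : i < n
  · exact congrFun he ⟨i, hi⟩
  · rw [List.getElem?_eq_none (by simp only; omega), List.getElem?_eq_none (by simp only; omega)]

instance finite_subgroup_ball {m : ℕ} (H : Subgroup (FreeGroup (Fin m))) (n : ℕ) :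
    Finite {g : FreeGroup (Fin m) // g ∈ H ∧ wlen g ≤ n} :=
  Finite.of_injective _ (injective_word_entries H n)

theorem card_subgroup_ball_le {m : ℕ} (H : Subgroup (FreeGroup (Fin m))) (n : ℕ) :
    Nat.card {g : FreeGroup (Fin m) // g ∈ H ∧ wlen g ≤ n} ≤ (m * 2 + 1) ^ n := by
  refine (Nat.card_le_card_of_injective _ (injective_word_entries H n)).trans ?_
  simp

theorem eventually_card_subgroup_ball_le {m : ℕ} (H : Subgroup (FreeGroup (Fin m))) {r : ℝ}
    (hr : Filter.limsup (fun n : ℕ =>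
        (Nat.card {g : FreeGroup (Fin m) // g ∈ H ∧ wlen g ≤ n} : ℝ) ^ ((n : ℝ)⁻¹)) atTop < r) :
    ∀ᶠ n : ℕ in atTop,
      (Nat.card {g : FreeGroup (Fin m) // g ∈ H ∧ wlen g ≤ n} : ℝ) ≤ r ^ n := by
  have hb : IsBoundedUnder (· ≤ ·) atTop fun n : ℕ =>
      (Nat.card {g : FreeGroup (Fin m) // g ∈ H ∧ wlen g ≤ n} : ℝ) ^ ((n : ℝ)⁻¹) := by
    refine isBoundedUnder_of_eventually_le (a := (m * 2 + 1 : ℝ)) ?_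
    filter_upwards [eventually_gt_atTop 0] with n hn
    rw [Real.rpow_inv_le_iff_of_pos (by positivity) (by positivity) (by positivity),
      Real.rpow_natCast]
    exact_mod_cast card_subgroup_ball_le H n
  filter_upwards [eventually_lt_of_limsup_lt hr hb, eventually_gt_atTop 0] with n hn hn0
  have h0 : 0 ≤ (Nat.card {g : FreeGroup (Fin m) // g ∈ H ∧ wlen g ≤ n} : ℝ) ^ ((n : ℝ)⁻¹) := by
    positivity
  rw [← Real.rpow_natCast, ← Real.rpow_inv_le_iff_of_pos (by positivity) (h0.trans hn.le)
    (by positivity)]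
  exact hn.le

theorem tsum_inv_pow_wlen_ne_top {m : ℕ} (H : Subgroup (FreeGroup (Fin m))) {s : ℝ} (hs : 0 < s)
    (hlt : Filter.limsup (fun n : ℕ =>
        (Nat.card {g : FreeGroup (Fin m) // g ∈ H ∧ wlen g ≤ n} : ℝ) ^ ((n : ℝ)⁻¹)) atTop < s) :
    ∑' h : H, ENNReal.ofReal (s⁻¹ ^ wlen (h : FreeGroup (Fin m))) ≠ ∞ := by
  obtain ⟨r, hr, hrs⟩ := exists_between (max_lt hlt hs)
  have hr0 : 0 < r := (le_max_right _ _).trans_lt hr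
  set N : ℕ → ℕ := fun n => Nat.card {g : FreeGroup (Fin m) // g ∈ H ∧ wlen g ≤ n}
  have hsum : Summable fun n => (N n : ℝ) * s⁻¹ ^ n := by
    refine Summable.of_norm_bounded_eventually_nat (g := fun n => (r * s⁻¹) ^ n)
      (summable_geometric_of_lt_one (by positivity) ?_) ?_
    · rwa [← div_eq_mul_inv, div_lt_one hs]
    · filter_upwards [eventually_card_subgroup_ball_le H ((le_max_left _ _).trans_lt hr)] with n hn
      rw [Real.norm_of_nonneg (by positivity), mul_pow]
      gcongr
  rw [← ENNReal.tsum_fiberwise _ fun h : H => wlen (h : FreeGroup (Fin m))]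
  refine ne_top_of_le_ne_top hsum.tsum_ofReal_ne_top (ENNReal.tsum_le_tsum fun n => ?_)
  rw [tsum_congr (g := fun _ => ENNReal.ofReal (s⁻¹ ^ n)) fun h => by
      rw [show wlen (h.1 : FreeGroup (Fin m)) = n from h.2],
    ENNReal.tsum_const, ENNReal.ofReal_mul (by positivity), ENNReal.ofReal_natCast]
  gcongr
  have hcard := ENat.card_le_card_of_injective
    (f := fun h : (fun h : H => wlen (h : FreeGroup (Fin m))) ⁻¹' {n} =>
      (⟨h.1.1, h.1.2, h.2.le⟩ : {g : FreeGroup (Fin m) // g ∈ H ∧ wlen g ≤ n}))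
    fun a b hab => Subtype.ext (Subtype.ext (congrArg
      (fun x : {g : FreeGroup (Fin m) // g ∈ H ∧ wlen g ≤ n} => x.1) hab))
  rw [ENat.card_eq_coe_natCard {g : FreeGroup (Fin m) // g ∈ H ∧ wlen g ≤ n}] at hcard
  exact_mod_cast hcard

theorem exists_minimal_translate {m : ℕ} (H : Subgroup (FreeGroup (Fin m)))
    (f : Boundary m → ℝ) (ω : Boundary m) (hfin : {h : H | lengthShift h.1 ω ≤ 0}.Finite) :
    ∃ h : H, ∀ k : H, 0 < lengthShift k.1 (bact h.1 ω) ∨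
      (lengthShift k.1 (bact h.1 ω) = 0 ∧ f (bact h.1 ω) ≤ f (bact k.1 (bact h.1 ω))) := by
  have hone : (1 : H) ∈ {h : H | lengthShift h.1 ω ≤ 0} := by simp [lengthShift_one]
  obtain ⟨h, hh, hmin⟩ := Set.exists_min_image _
    (fun h : H => toLex (lengthShift h.1 ω, f (bact h.1 ω))) hfin ⟨1, hone⟩
  refine ⟨h, fun k => ?_⟩
  have hmul := lengthShift_mul k.1 h.1 ω
  have hbact := bact_mul k.1 h.1 ω
  by_cases hk : lengthShift (k.1 * h.1) ω ≤ 0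
  · have := hmin (k * h) hk
    simp only [Prod.Lex.toLex_le_toLex, Subgroup.coe_mul, hmul, hbact] at this
    rcases this with h1 | ⟨h1, h2⟩
    · left; omega
    · exact Or.inr ⟨by omega, h2⟩
  · left
    have : lengthShift h.1 ω ≤ 0 := hh
    omega

theorem bact_ne_self_of_finite {m : ℕ} (H : Subgroup (FreeGroup (Fin m))) (ω : Boundary m)
    (hfin : {h : H | lengthShift h.1 ω ≤ 0}.Finite) (k : H) (hk : k ≠ 1) : bact k.1 ω ≠ ω := by
  intro hfix
  wlog hneg : lengthShift k.1 ω ≤ 0 generalizing k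
  · have h1 := bact_inv_bact k.1 ω
    have h2 := lengthShift_inv_bact k.1 ω
    rw [hfix] at h1 h2
    refine this k⁻¹ (inv_ne_one.mpr hk) h1 ?_
    rw [Subgroup.coe_inv]
    omega
  have hinj : Function.Injective fun n : ℕ => k ^ n := by
    intro a b hab
    have h1 : (k : FreeGroup (Fin m)) ^ a = (k : FreeGroup (Fin m)) ^ b := by
      exact_mod_cast congrArg Subtype.val hab
    exact IsMulTorsionFree.pow_right_injective (by simpa using hk) h1
  refine Set.infinite_of_injective_forall_mem hinj (fun n => ?_) hfin
  simp only [Set.mem_ofPred_eq, Subgroup.coe_pow]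
  rw [lengthShift_pow_of_bact_eq hfix]
  exact mul_nonpos_of_nonneg_of_nonpos (by positivity) hneg

/-- **Small cogrowth implies complete dissipativity.** If the exponential growth rate of
`H` inside `F` satisfies `v_H < √(2m-1)`, then the boundary action of `H` on `(∂F, μ)`
is completely dissipative. -/
theorem completely_dissipative_of_cogrowth_lt_sqrt (m : ℕ) (hm : 2 ≤ m)
    (μ : Measure (Boundary m)) [IsProbabilityMeasure μ]
    (hμ : ∀ g : FreeGroup (Fin m), g ≠ 1 →
      μ (cylinder g) = ((2 * m * (2 * m - 1) ^ (wlen g - 1) : ℕ) : ℝ≥0∞)⁻¹)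
    (H : Subgroup (FreeGroup (Fin m)))
    (hvH : Filter.limsup (fun n : ℕ =>
        (Nat.card {g : FreeGroup (Fin m) // g ∈ H ∧ wlen g ≤ n} : ℝ) ^ ((n : ℝ)⁻¹)) atTop
      < Real.sqrt ((2 * m - 1 : ℕ) : ℝ)) :
    ∃ W : Set (Boundary m), MeasurableSet W ∧
      (∀ h h' : H, h ≠ h' →
        μ (bact (h : FreeGroup (Fin m)) '' W ∩ bact (h' : FreeGroup (Fin m)) '' W) = 0) ∧
      μ (Set.univ \ ⋃ h : H, bact (h : FreeGroup (Fin m)) '' W) = 0 := by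
  set s := Real.sqrt ((2 * m - 1 : ℕ) : ℝ)
  have hs : 0 < s := Real.sqrt_pos.mpr (by exact_mod_cast (by omega : 0 < 2 * m - 1))
  have hae : ∀ᵐ ω ∂μ, {h : H | lengthShift h.1 ω ≤ 0}.Finite :=
    ae_finite_setOfPred_mem (s := fun h : H => {ω | lengthShift h.1 ω ≤ 0}) <|
      ne_top_of_le_ne_top (tsum_inv_pow_wlen_ne_top H hs hvH)
        (ENNReal.tsum_le_tsum fun h => measure_lengthShift_le hm μ hμ h.1)
  obtain ⟨e, he⟩ := exists_measurableEmbedding_real (ℕ → Letter m)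
  set f : Boundary m → ℝ := fun ω => e ω.1
  have hf : Measurable f := he.measurable.comp measurable_subtype_coe
  have hfinj : Function.Injective f := he.injective.comp Subtype.val_injective
  refine ⟨{ω | ∀ k : H, (0 < lengthShift k.1 ω ∨
    (lengthShift k.1 ω = 0 ∧ f ω ≤ f (bact k.1 ω))) ∧ (k ≠ 1 → bact k.1 ω ≠ ω)}, ?_, ?_, ?_⟩
  · have : Countable (FreeGroup (Fin m)) := FreeGroup.toWord_injective.countable
    rw [Set.ofPred_forall]
    refine MeasurableSet.iInter fun k => ((?_ : MeasurableSet _).union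
      ((?_ : MeasurableSet _).inter ?_)).inter ?_
    · exact measurable_lengthShift k.1 (MeasurableSet.of_discrete (s := Set.Ioi 0))
    · exact measurable_lengthShift k.1 (measurableSet_singleton 0)
    · exact measurableSet_le hf (hf.comp (measurable_bact k.1))
    · have heq : MeasurableSet {ω | bact k.1 ω = ω} := by
        have := measurableSet_eq_fun (hf.comp (measurable_bact k.1)) hf
        simpa only [Function.comp_apply, hfinj.eq_iff] using this
      by_cases hk : k = 1
      · simp only [hk, ne_eq, not_true_eq_false, false_imp_iff]
        exact MeasurableSet.const _
      · simp only [hk, ne_eq, not_false_eq_true, forall_const]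
        exact heq.compl
  · intro h h' hne
    rw [Set.disjoint_iff_inter_eq_empty.mp, measure_empty]
    rw [Set.disjoint_left]
    rintro _ ⟨ω, hω, rfl⟩ ⟨ω', hω', heq⟩
    set k : H := h'⁻¹ * h
    have hk : k ≠ 1 := fun hk => hne (inv_mul_eq_one.mp hk).symm
    have hkω : bact k.1 ω = ω' := by
      simp only [k, Subgroup.coe_mul, Subgroup.coe_inv]
      rw [bact_mul, ← heq, bact_inv_bact]
    have h1 := (hω k).1
    have h2 := (hω' k⁻¹).1
    have h3 := lengthShift_inv_bact k.1 ω
    have h4 := bact_inv_bact k.1 ω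
    rw [hkω] at h1 h3 h4
    rw [Subgroup.coe_inv, h3, h4] at h2
    have h5 : f ω = f ω' := by
      rcases h1 with h1 | ⟨h1, h1'⟩ <;> rcases h2 with h2 | ⟨h2, h2'⟩
      · omega
      · omega
      · omega
      · exact le_antisymm h1' h2'
    exact (hω k).2 hk (hkω.trans (hfinj h5).symm)
  · rw [ae_iff] at hae
    refine measure_mono_null (t := {ω | ¬{h : H | lengthShift h.1 ω ≤ 0}.Finite})
      (fun ω hω hfin => hω.2 ?_) hae
    obtain ⟨h, hh⟩ := exists_minimal_translate H f ω hfin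
    refine Set.mem_iUnion.mpr ⟨h⁻¹, bact h.1 ω, fun k => ⟨hh k, fun hk hfix => ?_⟩,
      bact_inv_bact h.1 ω⟩
    refine bact_ne_self_of_finite H ω hfin (h⁻¹ * k * h) (fun hc => hk ?_) ?_
    · rwa [mul_assoc, inv_mul_eq_one, eq_comm, mul_eq_right] at hc
    · simp only [Subgroup.coe_mul, Subgroup.coe_inv]
      rw [bact_mul, bact_mul, hfix, bact_inv_bact]
end
end
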